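/- arXiv:1608.08927 — 2 statements merged into one kernel-verified Lean document; each statement's English description precedes it below -/
import Mathlib

section
/- Let G be a context-free grammar over a type T of terminals. If G is non-recursive — i.e., for every nonterminal A, no sentential form reachable from the one-symbol string [A] by one or more production steps contains the symbol A — then for every nonterminal A, the set of sentential forms u with G.Derives [Symbol.nonterminal A] u is finite. -/
namespace ContextFreeRule

variable {T N : Type*} {r : ContextFreeRule T N}

lemma Rewrites.append_cases {u v w : List (Symbol T N)} (h : r.Rewrites (u ++ v) w) :
    (∃ u', w = u' ++ v ∧ r.Rewrites u u') ∨ ∃ v', w = u ++ v' ∧ r.Rewrites v v' := by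
  induction u generalizing w with
  | nil => exact Or.inr ⟨w, rfl, h⟩
  | cons x u ih =>
    rw [List.cons_append] at h
    cases h with
    | head => exact Or.inl ⟨r.output ++ u, by simp, Rewrites.head u⟩
    | cons _ h =>
      rcases ih h with ⟨u', rfl, hu⟩ | ⟨v', rfl, hv⟩
      · exact Or.inl ⟨x :: u', rfl, hu.cons x⟩
      · exact Or.inr ⟨v', rfl, hv⟩

lemma Rewrites.of_singleton {x : Symbol T N} {w : List (Symbol T N)} (h : r.Rewrites [x] w) :
    x = Symbol.nonterminal r.input ∧ w = r.output := by
  cases h with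
  | head => simp
  | cons _ h => cases h

end ContextFreeRule

namespace ContextFreeGrammar

variable {T : Type*} {G : ContextFreeGrammar T}

lemma Derives.exists_append {u v w : List (Symbol T G.NT)} (h : G.Derives (u ++ v) w) :
    ∃ u' v', w = u' ++ v' ∧ G.Derives u u' ∧ G.Derives v v' := by
  induction h with
  | refl => exact ⟨u, v, rfl, .refl _, .refl _⟩
  | tail _ hp ih =>
    obtain ⟨u', v', rfl, hu, hv⟩ := ih
    obtain ⟨r, hr, hrw⟩ := hp
    rcases hrw.append_cases with ⟨u'', rfl, h⟩ | ⟨v'', rfl, h⟩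
    · exact ⟨u'', v', rfl, hu.trans_produces ⟨r, hr, h⟩, hv⟩
    · exact ⟨u', v'', rfl, hu, hv.trans_produces ⟨r, hr, h⟩⟩

lemma finite_derives_of_forall_mem {u : List (Symbol T G.NT)}
    (h : ∀ B, Symbol.nonterminal B ∈ u → {w | G.Derives [Symbol.nonterminal B] w}.Finite) :
    {w | G.Derives u w}.Finite := by
  induction u with
  | nil =>
    refine (Set.finite_singleton []).subset fun w hw ↦ ?_
    rcases Derives.eq_or_head hw with rfl | ⟨v, ⟨r, -, hv⟩, -⟩
    · rfl
    · cases hv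
  | cons x u ih =>
    have hx : {w | G.Derives [x] w}.Finite := by
      cases x with
      | nonterminal B => exact h B (by simp)
      | terminal t =>
        refine (Set.finite_singleton [Symbol.terminal t]).subset fun w hw ↦ ?_
        rcases Derives.eq_or_head hw with rfl | ⟨v, ⟨r, -, hv⟩, -⟩
        · rfl
        · cases hv.of_singleton.1
    have hu := ih fun B hB ↦ h B (List.mem_cons_of_mem _ hB)
    refine (hx.image2 (· ++ ·) hu).subset fun w hw ↦ ?_
    obtain ⟨u', v', rfl, h₁, h₂⟩ := Derives.exists_append (u := [x]) (v := u) hw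
    exact ⟨u', h₁, v', h₂, rfl⟩

/-- A symbol derivable from a nonterminal occurring in `u` occurs in some form derivable from
`u`. -/
lemma exists_derives_mem_of_mem {B : G.NT} {u v : List (Symbol T G.NT)} {x : Symbol T G.NT}
    (hB : Symbol.nonterminal B ∈ u) (hv : G.Derives [Symbol.nonterminal B] v) (hx : x ∈ v) :
    ∃ w, G.Derives u w ∧ x ∈ w := by
  obtain ⟨p, q, rfl⟩ := List.append_of_mem hB
  refine ⟨p ++ (v ++ q), ?_, by simp [hx]⟩
  simpa using (hv.append_right q).append_left p

open Classical in
/-- The rules of `G` whose left-hand side occurs in some sentential form derivable from `A`. -/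
noncomputable def reachableRules (G : ContextFreeGrammar T) (A : G.NT) :
    Finset (ContextFreeRule T G.NT) :=
  G.rules.filter fun r ↦
    ∃ u, G.Derives [Symbol.nonterminal A] u ∧ Symbol.nonterminal r.input ∈ u

lemma reachableRules_ssubset
    (hnr : ∀ A : G.NT, ∀ u : List (Symbol T G.NT),
      Relation.TransGen G.Produces [Symbol.nonterminal A] u → Symbol.nonterminal A ∉ u)
    {r : ContextFreeRule T G.NT} (hr : r ∈ G.rules) {B : G.NT}
    (hB : Symbol.nonterminal B ∈ r.output) :
    G.reachableRules B ⊂ G.reachableRules r.input := by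
  classical
  have hp : G.Produces [Symbol.nonterminal r.input] r.output := ⟨r, hr, .input_output⟩
  rw [Finset.ssubset_iff_of_subset]
  · refine ⟨r, Finset.mem_filter.2 ⟨hr, _, .refl _, by simp⟩, fun h ↦ ?_⟩
    obtain ⟨-, u, hu, hru⟩ := Finset.mem_filter.1 h
    obtain ⟨w, hw, hrw⟩ := exists_derives_mem_of_mem hB hu hru
    exact hnr _ w (Relation.TransGen.head' hp hw) hrw
  · intro s hs
    obtain ⟨hs, u, hu, hsu⟩ := Finset.mem_filter.1 hs
    obtain ⟨w, hw, hsw⟩ := exists_derives_mem_of_mem hB hu hsu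
    exact Finset.mem_filter.2 ⟨hs, w, hp.trans_derives hw, hsw⟩

end ContextFreeGrammar

/-- If a context-free grammar `G` is non-recursive, then for every nonterminal `A`, the set of
sentential forms derivable from `[Symbol.nonterminal A]` is finite. -/
theorem nonrecursive_derivations_finite {T : Type*} (G : ContextFreeGrammar T)
    (hnr : ∀ A : G.NT, ∀ u : List (Symbol T G.NT),
      Relation.TransGen G.Produces [Symbol.nonterminal A] u → Symbol.nonterminal A ∉ u) :
    ∀ A : G.NT,
      {u : List (Symbol T G.NT) | G.Derives [Symbol.nonterminal A] u}.Finite := by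
  intro A
  induction hn : G.reachableRules A using Finset.strongInduction generalizing A with
  | H s ih =>
    subst hn
    have hfin : (⋃ r ∈ {r ∈ (G.rules : Set (ContextFreeRule T G.NT)) | r.input = A},
        {u | G.Derives r.output u}).Finite := by
      refine (G.rules.finite_toSet.subset fun r hr ↦ hr.1).biUnion ?_
      rintro r ⟨hr, rfl⟩
      exact ContextFreeGrammar.finite_derives_of_forall_mem fun B hB ↦
        ih _ (ContextFreeGrammar.reachableRules_ssubset hnr hr hB) B rfl
    refine (hfin.insert [Symbol.nonterminal A]).subset fun u hu ↦ ?_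
    rcases ContextFreeGrammar.Derives.eq_or_head hu with rfl | ⟨v, ⟨r, hr, hv⟩, hvu⟩
    · exact Set.mem_insert _ _
    · obtain ⟨hA, rfl⟩ := hv.of_singleton
      cases hA
      exact Set.mem_insert_of_mem _ (Set.mem_biUnion ⟨hr, rfl⟩ hvu)
end

section
/- Let G be a context-free grammar over a type T of terminals whose type of nonterminals is finite, such that every nonterminal is the left-hand side (input) of at least one production rule, and such that G is non-recursive — i.e., for every nonterminal A, no sentential form reachable from the one-symbol string [A] by one or more production steps contains the symbol A. Then the language of G is nonempty: there exists a terminal word s with s ∈ G.language. -/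
namespace ContextFreeGrammar

variable {T : Type*} (G : ContextFreeGrammar T)

/-- `G.Reaches B A` says that some sentential form obtained from `A` in one or more production
steps contains `B`. -/
def Reaches (B A : G.NT) : Prop :=
  ∃ u, Relation.TransGen G.Produces [Symbol.nonterminal A] u ∧ Symbol.nonterminal B ∈ u

variable {G}

lemma Reaches.trans {A B C : G.NT} (hCB : G.Reaches C B) (hBA : G.Reaches B A) :
    G.Reaches C A := by
  obtain ⟨v, hv, hCv⟩ := hCB
  obtain ⟨u, hu, hBu⟩ := hBA
  obtain ⟨p, q, rfl⟩ := List.append_of_mem hBu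
  refine ⟨p ++ (v ++ q), hu.trans ?_, by simp [hCv]⟩
  exact Relation.TransGen.lift (p := G.Produces) (fun w => p ++ (w ++ q))
    (fun _ _ h => (Produces.append_right h q).append_left p) _ _ hv

lemma exists_derives_map_terminal (u : List (Symbol T G.NT))
    (hu : ∀ A, Symbol.nonterminal A ∈ u →
      ∃ s : List T, G.Derives [Symbol.nonterminal A] (s.map Symbol.terminal)) :
    ∃ s : List T, G.Derives u (s.map Symbol.terminal) := by
  induction u with
  | nil => exact ⟨[], Derives.refl _⟩
  | cons x u ih =>
    obtain ⟨s, hs⟩ := ih fun A hA => hu A (List.mem_cons_of_mem _ hA)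
    cases x with
    | terminal t => exact ⟨t :: s, hs.append_left [Symbol.terminal t]⟩
    | nonterminal A =>
      obtain ⟨t, ht⟩ := hu A List.mem_cons_self
      refine ⟨t ++ s, ?_⟩
      rw [List.map_append]
      exact (ht.append_right u).trans (hs.append_left _)

end ContextFreeGrammar


/-- If a context-free grammar `G` has finitely many nonterminals, every nonterminal has at least
one production rule, and `G` is non-recursive, then the language of `G` is nonempty. -/
theorem nonrecursive_language_nonempty {T : Type*} (G : ContextFreeGrammar T)
    [Fintype G.NT]
    (htotal : ∀ A : G.NT, ∃ r ∈ G.rules, r.input = A)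
    (hnr : ∀ A : G.NT, ∀ u : List (Symbol T G.NT),
      Relation.TransGen G.Produces [Symbol.nonterminal A] u → Symbol.nonterminal A ∉ u) :
    ∃ s : List T, s ∈ G.language := by
  have : IsTrans G.NT G.Reaches := ⟨fun _ _ _ h₁ h₂ => h₁.trans h₂⟩
  have : Std.Irrefl G.Reaches := ⟨fun A ⟨u, hu, hA⟩ => hnr A u hu hA⟩
  have hwf : WellFounded G.Reaches := Finite.wellFounded_of_trans_of_irrefl _
  suffices h : ∀ A, ∃ s : List T,
      G.Derives [Symbol.nonterminal A] (s.map Symbol.terminal) from h G.initial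
  intro A
  induction A using hwf.induction with
  | _ A ih =>
    obtain ⟨r, hr, rfl⟩ := htotal A
    have hstep : G.Produces [Symbol.nonterminal r.input] r.output := ⟨r, hr, .input_output⟩
    obtain ⟨s, hs⟩ := ContextFreeGrammar.exists_derives_map_terminal r.output
      fun B hB => ih B ⟨r.output, .single hstep, hB⟩
    exact ⟨s, hstep.trans_derives hs⟩
end
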